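/- Let k be an infinite field and let d = 2s+1 be odd with d ≥ 5. For general forms f₁, f₂, f₃ of degree d in R = k[x,y] with I = (f₁, f₂, f₃), suppose that 𝔪^{s−1}·(Ĩ)² ⊆ I², where 𝔪 = (x,y), Ĩ = (x²·δ(I), x·y^{d−1}, y^d), δ(f) for a form f of degree d is the unique form of degree d−2 with f = δ(f)·x² + a·x·y^{d−1} + b·y^d for some a, b ∈ k, and δ(I) = (δ(f₁), δ(f₂), δ(f₃)). Then the annihilator of the R/I-module I/I² contains a monomial whose residue class spans (R/I)_{3s}; in particular I² : I ≠ I. -/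

import Mathlib

open MvPolynomial

noncomputable section

/-- The binary form of degree `d` in `k[x,y]` with coefficient vector `c`
(`x := X 0`, `y := X 1`). -/
def formOf {k : Type*} [Field k] (d : ℕ) (c : Fin (d + 1) → k) :
    MvPolynomial (Fin 2) k :=
  ∑ l : Fin (d + 1), C (c l) * X 0 ^ (l : ℕ) * X 1 ^ (d - (l : ℕ))

/-- The degree-`j` graded piece of `R/I`, `R = k[x,y]`: the image of the homogeneous
polynomials of degree `j` in the quotient, as a `k`-vector space. -/
def quotPiece {k : Type*} [Field k] (I : Ideal (MvPolynomial (Fin 2) k)) (j : ℕ) :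
    Submodule k (MvPolynomial (Fin 2) k ⧸ I) :=
  Submodule.map (Ideal.Quotient.mkₐ k I).toLinearMap (homogeneousSubmodule (Fin 2) k j)

/-- The exponent vector of `x ^ a * y ^ b`. -/
def expVec (a b : ℕ) : Fin 2 →₀ ℕ := Finsupp.single 0 a + Finsupp.single 1 b

/-- A finite coefficient vector, extended by zero to all of `ℕ`. -/
def extendZero {k : Type*} [Zero k] {d : ℕ} (c : Fin (d + 1) → k) (i : ℕ) : k :=
  if h : i < d + 1 then c ⟨i, h⟩ else 0

section

variable {k : Type*} [Field k]

theorem expVec_eta (m : Fin 2 →₀ ℕ) : expVec (m 0) (m 1) = m := by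
  ext i; fin_cases i <;> simp [expVec]

theorem expVec_inj {a b a' b' : ℕ} : expVec a b = expVec a' b' ↔ a = a' ∧ b = b' := by
  constructor
  · intro h
    have h0 := DFunLike.congr_fun h 0
    have h1 := DFunLike.congr_fun h 1
    simpa [expVec] using And.intro h0 h1
  · rintro ⟨rfl, rfl⟩; rfl

theorem degree_expVec (a b : ℕ) : (expVec a b).degree = a + b := by
  simp [expVec]

theorem monomial_expVec (a b : ℕ) (r : k) :
    monomial (expVec a b) r = C r * X 0 ^ a * X 1 ^ b := by
  rw [X_pow_eq_monomial, X_pow_eq_monomial, C_mul_monomial, monomial_mul, expVec]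
  simp

theorem coeff_X_pow_mul (a b e f : ℕ) (p : MvPolynomial (Fin 2) k) :
    coeff (expVec a b) (X 0 ^ e * X 1 ^ f * p) =
      if e ≤ a ∧ f ≤ b then coeff (expVec (a - e) (b - f)) p else 0 := by
  have h := monomial_expVec (k := k) e f 1
  rw [C_1, one_mul] at h
  rw [← h, coeff_monomial_mul', one_mul]
  have h1 : expVec e f ≤ expVec a b ↔ e ≤ a ∧ f ≤ b := by
    simp [Finsupp.le_def, Fin.forall_fin_two, expVec]
  have h2 : expVec a b - expVec e f = expVec (a - e) (b - f) := by
    ext i; fin_cases i <;> simp [expVec]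
  rw [h2]
  simp only [h1]

theorem coeff_formOf (d : ℕ) (c : Fin (d + 1) → k) (a b : ℕ) :
    coeff (expVec a b) (formOf d c) = if a + b = d then extendZero c a else 0 := by
  simp only [formOf, coeff_sum, ← monomial_expVec, coeff_monomial, expVec_inj]
  split_ifs with h
  · have ha : a < d + 1 := by omega
    rw [Finset.sum_eq_single ⟨a, ha⟩]
    · rw [if_pos ⟨rfl, by simp; omega⟩]; simp [extendZero, ha]
    · intro l _ hl
      exact if_neg fun h' => hl (Fin.ext h'.1)
    · simp
  · exact Finset.sum_eq_zero fun l _ => if_neg fun h' => by omega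

theorem formOf_isHomogeneous (d : ℕ) (c : Fin (d + 1) → k) : (formOf d c).IsHomogeneous d := by
  refine IsHomogeneous.sum _ _ _ fun l _ => ?_
  rw [← monomial_expVec]
  exact isHomogeneous_monomial _ (by rw [degree_expVec]; omega)

theorem formOf_coeff {N : ℕ} {p : MvPolynomial (Fin 2) k} (hp : p.IsHomogeneous N) :
    formOf N (fun l => coeff (expVec l (N - l)) p) = p := by
  ext m
  rw [← expVec_eta m, coeff_formOf]
  split_ifs with h
  · have h' : m 0 < N + 1 := by omega
    have h'' : N - m 0 = m 1 := by omega
    simp [extendZero, h', h'']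
  · rw [hp.coeff_eq_zero]
    rwa [degree_expVec]

theorem isHomogeneous_X_pow_mul {e f n N : ℕ} {p : MvPolynomial (Fin 2) k}
    (hp : p.IsHomogeneous n) (h : e + f + n = N) :
    (X 0 ^ e * X 1 ^ f * p : MvPolynomial (Fin 2) k).IsHomogeneous N := by
  subst h
  simpa using (((isHomogeneous_X k 0).pow e).mul ((isHomogeneous_X k 1).pow f)).mul hp

/-- The matrix whose rows are the coefficient vectors of the `h n` in degree `N`. -/
def coeffMatrix {N : ℕ} (h : Fin (N + 1) → MvPolynomial (Fin 2) k) :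
    Matrix (Fin (N + 1)) (Fin (N + 1)) k :=
  Matrix.of fun n l => coeff (expVec l (N - l)) (h n)

theorem exists_eq_sum_of_det_ne_zero {N : ℕ} {h : Fin (N + 1) → MvPolynomial (Fin 2) k}
    (hh : ∀ n, (h n).IsHomogeneous N) (hdet : (coeffMatrix h).det ≠ 0)
    {p : MvPolynomial (Fin 2) k} (hp : p.IsHomogeneous N) :
    ∃ w : Fin (N + 1) → k, p = ∑ n, C (w n) * h n := by
  set M := coeffMatrix h
  have hM : IsUnit M.det := hdet.isUnit
  refine ⟨Matrix.vecMul (fun l : Fin (N + 1) => coeff (expVec l (N - l)) p) M⁻¹, ?_⟩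
  set w := Matrix.vecMul (fun l : Fin (N + 1) => coeff (expVec l (N - l)) p) M⁻¹ with hw
  have key : Matrix.vecMul w M = fun l : Fin (N + 1) => coeff (expVec l (N - l)) p := by
    rw [hw, Matrix.vecMul_vecMul, Matrix.nonsing_inv_mul _ hM, Matrix.vecMul_one]
  have hs : (∑ n, C (w n) * h n).IsHomogeneous N :=
    IsHomogeneous.sum _ _ _ fun n _ => by
      simpa using (isHomogeneous_C (Fin 2) (w n)).mul (hh n)
  rw [← formOf_coeff hp, ← formOf_coeff hs]
  congr 1
  funext l
  rw [← congrFun key l]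
  simp [Matrix.vecMul, dotProduct, coeff_sum, coeff_C_mul, M, coeffMatrix]

/-- A linear functional on coefficients in degree `N` that vanishes on the degree-`N` monomial
multiples of a form `f` vanishes on all multiples of `f`. -/
theorem sum_coeff_mul_eq_zero {N n : ℕ} (v : Fin (N + 1) → k) {f : MvPolynomial (Fin 2) k}
    (hf : f.IsHomogeneous n)
    (hv : ∀ a b, a + b + n = N →
      ∑ l : Fin (N + 1), coeff (expVec l (N - l)) (X 0 ^ a * X 1 ^ b * f) * v l = 0)
    (r : MvPolynomial (Fin 2) k) :
    ∑ l : Fin (N + 1), coeff (expVec l (N - l)) (r * f) * v l = 0 := by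
  induction r using MvPolynomial.induction_on' with
  | monomial u t =>
    rw [← expVec_eta u, monomial_expVec]
    simp only [mul_assoc (C t), coeff_C_mul]
    by_cases h : u 0 + u 1 + n = N
    · simp only [mul_assoc t, ← Finset.mul_sum, hv _ _ h, mul_zero]
    · refine Finset.sum_eq_zero fun l _ => ?_
      rw [(isHomogeneous_X_pow_mul hf rfl).coeff_eq_zero, mul_zero, zero_mul]
      rw [degree_expVec]; omega
  | add p q hp hq =>
    simp only [add_mul, coeff_add, Finset.sum_add_distrib, hp, hq, add_zero]

/-- A square matrix whose rows are either unit vectors or shifted coefficient vectors of one of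
three forms is invertible for general forms, provided the shifts are compatible with
an assignment `st` of a single monomial to each form. -/
theorem exists_generic_det_ne_zero {d N : ℕ} (t z : ℕ) (J : Fin (N + 1) → Fin 3)
    (E : Fin (N + 1) → ℕ) (st : Fin 3 → ℕ) (hst : ∀ j, st j + t ≤ d)
    (hE : ∀ n : Fin (N + 1), z ≤ n → E n + st (J n) = n) :
    ∃ P : MvPolynomial (Fin 3 × Fin (d + 1)) k, P ≠ 0 ∧
      ∀ c : Fin 3 → Fin (d + 1) → k, eval (fun p => c p.1 p.2) P ≠ 0 →
        (Matrix.of fun n l : Fin (N + 1) =>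
          if (n : ℕ) < z then (if n = l then (1 : k) else 0) else
            if E n ≤ l then extendZero (c (J n)) (l - E n + t) else 0).det ≠ 0 := by
  let M : Matrix (Fin (N + 1)) (Fin (N + 1)) (MvPolynomial (Fin 3 × Fin (d + 1)) k) :=
    Matrix.of fun n l =>
      if (n : ℕ) < z then (if n = l then 1 else 0) else
        if E n ≤ l then extendZero (fun i : Fin (d + 1) => X (J n, i)) (l - E n + t) else 0
  have hM : ∀ c : Fin 3 → Fin (d + 1) → k, eval (fun p => c p.1 p.2) M.det =
      (Matrix.of fun n l : Fin (N + 1) =>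
          if (n : ℕ) < z then (if n = l then (1 : k) else 0) else
            if E n ≤ l then extendZero (c (J n)) (l - E n + t) else 0).det := by
    intro c
    rw [RingHom.map_det]
    congr 1
    ext n l
    simp only [RingHom.mapMatrix_apply, Matrix.map_apply, Matrix.of_apply, M, extendZero]
    split_ifs <;> simp
  refine ⟨M.det, fun h0 => ?_, fun c hc => by rwa [hM] at hc⟩
  have h1 := hM fun j i => if (i : ℕ) = st j + t then 1 else 0
  rw [h0, map_zero] at h1
  have h2 : (Matrix.of fun n l : Fin (N + 1) =>
          if (n : ℕ) < z then (if n = l then (1 : k) else 0) else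
            if E n ≤ l then extendZero (fun i : Fin (d + 1) =>
              if (i : ℕ) = st (J n) + t then (1 : k) else 0) (l - E n + t) else 0) = 1 := by
    ext n l
    rw [Matrix.of_apply, Matrix.one_apply]
    by_cases hz : (n : ℕ) < z
    · rw [if_pos hz]
    · rw [if_neg hz]
      have := hE n (by omega)
      have := hst (J n)
      simp only [extendZero, Fin.ext_iff]
      split_ifs <;> first | rfl | omega
  rw [h2, Matrix.det_one] at h1
  exact zero_ne_one h1

theorem coeff_cofactor {d : ℕ} {c : Fin (d + 1) → k} {g : MvPolynomial (Fin 2) k}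
    {a b : k} (h : formOf d c = g * X 0 ^ 2 + C a * X 0 * X 1 ^ (d - 1) + C b * X 1 ^ d)
    {i j : ℕ} (hij : i + 2 + j = d) : coeff (expVec i j) g = extendZero c (i + 2) := by
  have h1 := coeff_formOf d c (i + 2) j
  rw [if_pos hij, h] at h1
  rw [← h1, coeff_add, coeff_add]
  have e1 := monomial_expVec 1 (d - 1) a
  have e2 := monomial_expVec 0 d b
  have e3 := coeff_X_pow_mul (i + 2) j 2 0 g
  rw [pow_one] at e1
  rw [pow_zero, mul_one] at e2
  rw [← e1, ← e2, coeff_monomial, coeff_monomial, if_neg, if_neg, mul_comm g]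
  · simpa using e3.symm
  · rw [expVec_inj]; omega
  · rw [expVec_inj]; omega

theorem X_pow_mul_X_pow_mem (a b : ℕ) :
    (X 0 ^ a * X 1 ^ b : MvPolynomial (Fin 2) k) ∈
      (Ideal.span {(X 0 : MvPolynomial (Fin 2) k), X 1}) ^ (a + b) := by
  rw [pow_add]
  exact Ideal.mul_mem_mul (Ideal.pow_mem_pow (Ideal.subset_span (by simp)) _)
    (Ideal.pow_mem_pow (Ideal.subset_span (by simp)) _)

/-- If forms of degree `3s-1` are combinations of the `𝔪 ^ s * g j`, then every multiple of
`y ^ (2s)` of degree `5s+1` lies in `𝔪 ^ (s-1) * Ĩ ^ 2`. -/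
theorem X_pow_mul_mem_of_isHomogeneous {s d : ℕ} (hs : 2 ≤ s) (hd : d = 2 * s + 1)
    {g : Fin 3 → MvPolynomial (Fin 2) k} {ι : Type*} [Fintype ι] (J : ι → Fin 3) (E : ι → ℕ)
    (hE : ∀ n, E n ≤ s)
    (hg : ∀ p : MvPolynomial (Fin 2) k, p.IsHomogeneous (3 * s - 1) →
      ∃ w : ι → k, p = ∑ n, C (w n) * (X 0 ^ E n * X 1 ^ (s - E n) * g (J n)))
    {p : MvPolynomial (Fin 2) k} (hp : p.IsHomogeneous (3 * s + 1)) :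
    X 1 ^ (2 * s) * p ∈ (Ideal.span {(X 0 : MvPolynomial (Fin 2) k), X 1}) ^ (s - 1) *
      (Ideal.span {X 0 ^ 2 * g 0, X 0 ^ 2 * g 1, X 0 ^ 2 * g 2,
        X 0 * X 1 ^ (d - 1), X 1 ^ d}) ^ 2 := by
  subst hd
  set A := Ideal.span {(X 0 : MvPolynomial (Fin 2) k), X 1}
  set B := Ideal.span {X 0 ^ 2 * g 0, X 0 ^ 2 * g 1, X 0 ^ 2 * g 2,
        X 0 * X 1 ^ (2 * s + 1 - 1), X 1 ^ (2 * s + 1)} with hB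
  have hBg : ∀ j, X 0 ^ 2 * g j ∈ B := fun j => Ideal.subset_span (by fin_cases j <;> simp)
  have hB1 : X 0 * X 1 ^ (2 * s) ∈ B := Ideal.subset_span (by simp)
  have hB2 : X 1 ^ (2 * s + 1) ∈ B := Ideal.subset_span (by simp)
  have key : ∀ a b, a + b = s - 1 → ∀ u ∈ B, ∀ v ∈ B,
      X 0 ^ a * X 1 ^ b * (u * v) ∈ A ^ (s - 1) * B ^ 2 := by
    intro a b hab u hu v hv
    rw [sq B, ← hab]
    exact Ideal.mul_mem_mul (X_pow_mul_X_pow_mem a b) (Ideal.mul_mem_mul hu hv)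
  obtain ⟨s, rfl⟩ : ∃ r, s = r + 1 := ⟨s - 1, by omega⟩
  rw [← formOf_coeff hp, formOf, Finset.mul_sum]
  refine Ideal.sum_mem _ fun l _ => ?_
  rw [mul_assoc (C _), mul_left_comm]
  refine Ideal.mul_mem_left _ _ ?_
  obtain ⟨l, hl⟩ := l
  simp only
  rcases l with _ | _ | l
  · convert key 0 s (by omega) _ hB2 _ hB2 using 1
    rw [show 3 * (s + 1) + 1 - 0 = 3 * s + 4 by omega]
    ring
  · convert key 0 s (by omega) _ hB1 _ hB2 using 1
    rw [show 3 * (s + 1) + 1 - (0 + 1) = 3 * s + 3 by omega]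
    ring
  · obtain ⟨w, hw⟩ := hg (X 0 ^ l * X 1 ^ (3 * (s + 1) + 1 - (l + 1 + 1)))
      (by simpa using isHomogeneous_X_pow_mul (isHomogeneous_one (Fin 2) k) (by omega))
    have : (X 1 ^ (2 * (s + 1)) * (X 0 ^ (l + 1 + 1) * X 1 ^ (3 * (s + 1) + 1 - (l + 1 + 1))) :
        MvPolynomial (Fin 2) k) = X 0 ^ 2 * X 1 ^ (2 * (s + 1)) *
          (X 0 ^ l * X 1 ^ (3 * (s + 1) + 1 - (l + 1 + 1))) := by ring
    rw [this, hw, Finset.mul_sum]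
    refine Ideal.sum_mem _ fun n _ => ?_
    rw [mul_left_comm]
    refine Ideal.mul_mem_left _ _ ?_
    have hEn := hE n
    rcases he : E n with _ | e
    · convert key 0 s (by omega) _ (hBg (J n)) _ hB2 using 1
      rw [Nat.sub_zero]
      ring
    · convert key e (s - e) (by omega) _ (hBg (J n)) _ hB1 using 1
      rw [show s + 1 - (e + 1) = s - e by omega]
      ring

end

/-- For an infinite field `k` and odd `d = 2s+1 ≥ 5`, for general forms `f₁, f₂, f₃` of
degree `d` in `R = k[x,y]` (genericity encoded as the nonvanishing locus of a nonzero
polynomial), with `I = (f₁,f₂,f₃)`: writing `f_j = δ(f_j)·x² + a_j·x·y^{d−1} + b_j·y^d`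
with `δ(f_j)` homogeneous of degree `d−2`, set `δ(I) = (δ(f₁),δ(f₂),δ(f₃))` and
`Ĩ = (x²·δ(I), x·y^{d−1}, y^d)`. If `𝔪^{s−1}·Ĩ² ⊆ I²` (where `𝔪 = (x,y)`), then the
annihilator `I² : I` of the `R/I`-module `I/I²` contains a monomial of degree `3s`
whose residue class spans `(R/I)_{3s}`; in particular `I² : I ≠ I`. -/
theorem conjecture_implies_colon_neq (k : Type*) [Field k] [Infinite k]
    (s d : ℕ) (hs : 2 ≤ s) (hd : d = 2 * s + 1) :
    ∃ P : MvPolynomial (Fin 3 × Fin (d + 1)) k, P ≠ 0 ∧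
      ∀ c : Fin 3 → Fin (d + 1) → k,
        eval (fun p => c p.1 p.2) P ≠ 0 →
          ∀ (g : Fin 3 → MvPolynomial (Fin 2) k) (a b : Fin 3 → k),
            (∀ j, (g j).IsHomogeneous (d - 2)) →
            (∀ j, formOf d (c j) =
              g j * X 0 ^ 2 + C (a j) * X 0 * X 1 ^ (d - 1) + C (b j) * X 1 ^ d) →
            (Ideal.span {(X 0 : MvPolynomial (Fin 2) k), X 1}) ^ (s - 1) *
                (Ideal.span {X 0 ^ 2 * g 0, X 0 ^ 2 * g 1, X 0 ^ 2 * g 2,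
                  X 0 * X 1 ^ (d - 1), X 1 ^ d}) ^ 2 ≤
              (Ideal.span {formOf d (c 0), formOf d (c 1), formOf d (c 2)}) ^ 2 →
            (∃ i j : ℕ, i + j = 3 * s ∧
              (X 0 : MvPolynomial (Fin 2) k) ^ i * X 1 ^ j ∈
                Submodule.colon
                  ((Ideal.span {formOf d (c 0), formOf d (c 1), formOf d (c 2)}) ^ 2)
                  (Ideal.span {formOf d (c 0), formOf d (c 1), formOf d (c 2)}) ∧
              Submodule.span k
                  {Ideal.Quotient.mk
                    (Ideal.span {formOf d (c 0), formOf d (c 1), formOf d (c 2)})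
                    (X 0 ^ i * X 1 ^ j)} =
                quotPiece (Ideal.span {formOf d (c 0), formOf d (c 1), formOf d (c 2)})
                  (3 * s)) ∧
            Submodule.colon
                ((Ideal.span {formOf d (c 0), formOf d (c 1), formOf d (c 2)}) ^ 2)
                (Ideal.span {formOf d (c 0), formOf d (c 1), formOf d (c 2)}) ≠
              Ideal.span {formOf d (c 0), formOf d (c 1), formOf d (c 2)} := by
  subst hd
  let J₁ : Fin (3 * s - 1 + 1) → Fin 3 := fun n =>
    ⟨n / s, Nat.div_lt_of_lt_mul (by have := n.2; omega)⟩
  let st₁ : Fin 3 → ℕ := ![0, s, 2 * s - 1]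
  let E₁ : Fin (3 * s - 1 + 1) → ℕ := fun n => n - st₁ (J₁ n)
  have hE₁ : ∀ n, E₁ n + st₁ (J₁ n) = n ∧ E₁ n ≤ s := by
    intro n
    have hn := n.2
    have h1 := Nat.div_add_mod (n : ℕ) s
    have h2 := Nat.mod_lt (n : ℕ) (show 0 < s by omega)
    have hJ : (J₁ n : ℕ) = n / s := rfl
    rw [← hJ] at h1
    simp only [E₁]
    generalize J₁ n = j at h1 ⊢
    fin_cases j <;> simp [st₁] at h1 ⊢ <;> omega
  let J₂ : Fin (3 * s + 1) → Fin 3 := fun n =>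
    ⟨(n - 1) / s, Nat.div_lt_of_lt_mul (by have := n.2; omega)⟩
  let st₂ : Fin 3 → ℕ := fun j => s * j + 1
  let E₂ : Fin (3 * s + 1) → ℕ := fun n => (n - 1) % s
  have hE₂ : ∀ n : Fin (3 * s + 1), 1 ≤ (n : ℕ) → E₂ n + st₂ (J₂ n) = n := by
    intro n hn
    have h1 := Nat.div_add_mod ((n : ℕ) - 1) s
    simp only [E₂, st₂, J₂]
    omega
  have hE₂' : ∀ n, E₂ n ≤ s - 1 := fun n => by
    have := Nat.mod_lt ((n : ℕ) - 1) (show 0 < s by omega)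
    simp only [E₂]
    omega
  obtain ⟨P₁, hP₁, H₁⟩ := exists_generic_det_ne_zero (k := k) (d := 2 * s + 1) 2 0 J₁ E₁ st₁
    (by intro j; fin_cases j <;> simp [st₁] <;> omega) (fun n _ => (hE₁ n).1)
  obtain ⟨P₂, hP₂, H₂⟩ := exists_generic_det_ne_zero (k := k) (d := 2 * s + 1) 0 1 J₂ E₂ st₂
    (by intro j; fin_cases j <;> simp [st₂] <;> omega) hE₂
  refine ⟨P₁ * P₂, mul_ne_zero hP₁ hP₂, ?_⟩
  intro c hc g a b hg hfg hle
  rw [map_mul] at hc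
  have D₁ := H₁ c (left_ne_zero_of_mul hc)
  have D₂ := H₂ c (right_ne_zero_of_mul hc)
  set I := Ideal.span {formOf (2 * s + 1) (c 0), formOf (2 * s + 1) (c 1),
    formOf (2 * s + 1) (c 2)} with hI
  have hIf : ∀ j, formOf (2 * s + 1) (c j) ∈ I := fun j =>
    Ideal.subset_span (by fin_cases j <;> simp)
  have hG : ∀ p : MvPolynomial (Fin 2) k, p.IsHomogeneous (3 * s - 1) →
      ∃ w : Fin (3 * s - 1 + 1) → k,
        p = ∑ n, C (w n) * (X 0 ^ E₁ n * X 1 ^ (s - E₁ n) * g (J₁ n)) := by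
    intro p hp
    refine exists_eq_sum_of_det_ne_zero (fun n => isHomogeneous_X_pow_mul (hg _) ?_) ?_ hp
    · have := (hE₁ n).2
      omega
    · convert D₁ using 2
      ext n l
      have hl := l.2
      have hEn := (hE₁ n).2
      simp only [coeffMatrix, Matrix.of_apply, coeff_X_pow_mul, not_lt_zero, if_false]
      by_cases h1 : E₁ n ≤ l
      · by_cases h2 : s - E₁ n ≤ 3 * s - 1 - l
        · rw [if_pos ⟨h1, h2⟩, if_pos h1]
          exact coeff_cofactor (hfg _) (by omega)
        · rw [if_neg (by tauto), if_pos h1, extendZero, dif_neg (by omega)]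
      · rw [if_neg (by tauto), if_neg h1]
  let h₂ : Fin (3 * s + 1) → MvPolynomial (Fin 2) k := fun n =>
    if (n : ℕ) < 1 then X 1 ^ (3 * s) else
      X 0 ^ E₂ n * X 1 ^ (s - 1 - E₂ n) * formOf (2 * s + 1) (c (J₂ n))
  have hY : (X 1 ^ (3 * s) : MvPolynomial (Fin 2) k).IsHomogeneous (3 * s) := by
    simpa using (isHomogeneous_X k (1 : Fin 2)).pow (3 * s)
  have hh₂ : ∀ n, (h₂ n).IsHomogeneous (3 * s) := by
    intro n
    simp only [h₂]
    split_ifs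
    · exact hY
    · have := hE₂' n
      exact isHomogeneous_X_pow_mul (formOf_isHomogeneous _ _) (by omega)
  have hrow : ∀ (n l : Fin (3 * s + 1)), coeff (expVec l (3 * s - l)) (h₂ n) =
      if (n : ℕ) < 1 then (if n = l then (1 : k) else 0) else
            if E₂ n ≤ l then extendZero (c (J₂ n)) (l - E₂ n + 0) else 0 := by
    intro n l
    have hl := l.2
    have hEn := hE₂' n
    simp only [h₂]
    split_ifs with h0 h1 h1
    · have e := monomial_expVec 0 (3 * s) (1 : k)
      rw [pow_zero, mul_one, C_1, one_mul] at e
      rw [← e, coeff_monomial, if_pos]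
      rw [expVec_inj, ← h1]
      omega
    · have e := monomial_expVec 0 (3 * s) (1 : k)
      rw [pow_zero, mul_one, C_1, one_mul] at e
      rw [← e, coeff_monomial, if_neg]
      rw [expVec_inj]
      rintro ⟨h, -⟩
      exact h1 (Fin.ext (by omega))
    · rw [coeff_X_pow_mul]
      by_cases h2 : s - 1 - E₂ n ≤ 3 * s - l
      · rw [if_pos ⟨h1, h2⟩, coeff_formOf, if_pos (by omega), add_zero]
      · rw [if_neg (by tauto), extendZero, dif_neg (by omega)]
    · rw [coeff_X_pow_mul, if_neg (by tauto)]
  have D₂' : (coeffMatrix h₂).det ≠ 0 := by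
    convert D₂ using 2
    ext n l
    exact hrow n l
  have hmem : (X 1 ^ (3 * s) : MvPolynomial (Fin 2) k) ∈ Submodule.colon (I ^ 2) (I : Set _) := by
    rw [hI, Ideal.colon_span, ← hI, Submodule.mem_colon]
    have hj : ∀ j, X 1 ^ (3 * s) * formOf (2 * s + 1) (c j) ∈ I ^ 2 := by
      intro j
      have h := X_pow_mul_mem_of_isHomogeneous hs rfl J₁ E₁ (fun n => (hE₁ n).2) hG
        (p := X 0 ^ 0 * X 1 ^ s * formOf (2 * s + 1) (c j))
        (isHomogeneous_X_pow_mul (formOf_isHomogeneous _ _) (by omega))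
      convert hle h using 1
      ring
    rintro p (rfl | rfl | rfl)
    exacts [hj 0, hj 1, hj 2]
  have hnot : (X 1 ^ (3 * s) : MvPolynomial (Fin 2) k) ∉ I := by
    intro hyI
    set v : Fin (3 * s + 1) → k := Matrix.mulVec (coeffMatrix h₂)⁻¹ (Pi.single 0 1) with hv
    have hMv : Matrix.mulVec (coeffMatrix h₂) v = Pi.single 0 1 := by
      rw [hv, Matrix.mulVec_mulVec, Matrix.mul_nonsing_inv _ D₂'.isUnit, Matrix.one_mulVec]
    have hn : ∀ n, ∑ l : Fin (3 * s + 1), coeff (expVec l (3 * s - l)) (h₂ n) * v l =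
        (Pi.single 0 1 : Fin (3 * s + 1) → k) n := fun n => congrFun hMv n
    have hz : ∀ j r, ∑ l : Fin (3 * s + 1),
        coeff (expVec l (3 * s - l)) (r * formOf (2 * s + 1) (c j)) * v l = 0 := by
      intro j
      refine sum_coeff_mul_eq_zero v (formOf_isHomogeneous _ _) fun e f hef => ?_
      have hj := j.2
      have hjs : s * (j : ℕ) ≤ s * 2 := Nat.mul_le_mul_left s (by omega)
      let n : Fin (3 * s + 1) := ⟨s * j + e + 1, by omega⟩
      have hJ : J₂ n = j := by
        apply Fin.ext
        simp only [J₂, n, Nat.add_sub_cancel]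
        rw [Nat.mul_add_div (by omega), Nat.div_eq_of_lt (by omega), add_zero]
      have hE : E₂ n = e := by
        simp only [E₂, n, Nat.add_sub_cancel]
        rw [Nat.mul_add_mod, Nat.mod_eq_of_lt (by omega)]
      have hh : h₂ n = X 0 ^ e * X 1 ^ f * formOf (2 * s + 1) (c j) := by
        simp only [h₂]
        rw [if_neg (by simp [n]), hJ, hE, show s - 1 - e = f by omega]
      rw [← hh, hn n, Pi.single_eq_of_ne]
      exact fun h => Nat.succ_ne_zero _ (congrArg Fin.val h)
    obtain ⟨r₀, q, hq, hr⟩ := Ideal.mem_span_insert.1 hyI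
    obtain ⟨r₁, r₂, hr'⟩ := Ideal.mem_span_pair.1 hq
    have h0 := hn 0
    have : h₂ 0 = X 1 ^ (3 * s) := by simp [h₂]
    rw [this, hr, ← hr'] at h0
    simp only [coeff_add, add_mul, Finset.sum_add_distrib, hz, add_zero, Pi.single_eq_same] at h0
    exact zero_ne_one h0
  refine ⟨⟨0, 3 * s, by omega, by simpa using hmem, ?_⟩, fun h => hnot (h ▸ hmem)⟩
  rw [pow_zero, one_mul]
  apply le_antisymm
  · rw [Submodule.span_singleton_le_iff_mem]
    exact ⟨_, hY, rfl⟩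
  · rintro _ ⟨p, hp, rfl⟩
    obtain ⟨w, hw⟩ := exists_eq_sum_of_det_ne_zero hh₂ D₂' hp
    rw [hw, map_sum]
    refine Submodule.sum_mem _ fun n _ => ?_
    rw [← smul_eq_C_mul, map_smul]
    refine Submodule.smul_mem _ _ ?_
    simp only [h₂]
    split_ifs
    · exact Submodule.mem_span_singleton_self _
    · convert Submodule.zero_mem _
      exact Ideal.Quotient.eq_zero_iff_mem.2 (Ideal.mul_mem_left _ _ (hIf _))
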